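/- Let β be a weight sequence with associated sequence γ. Then for all z, w ∈ 𝔹ⁿ the family (ρ₁(𝐤)/γ_{|𝐤|} · z^𝐤 w̄^𝐤)_{𝐤∈ℤ₊ⁿ} is absolutely summable and Σ_{𝐤∈ℤ₊ⁿ} (ρ₁(𝐤)/γ_{|𝐤|}) z^𝐤 w̄^𝐤 = Σ_{j≥0} γ_j^{−1} ⟨z,w⟩^j = (1 − ⟨z,w⟩) Σ_{j≥0} β_j^{−1} ⟨z,w⟩^j, where ⟨z,w⟩ = Σᵢ zᵢ w̄ᵢ. Equivalently, for any Hilbert space ℰ, Ψ_{β,ℰ}(z) Ψ_{β,ℰ}(w)* = (1 − ⟨z,w⟩) K_β(z,w) I_ℰ where K_β(z,w) = Σ_{j≥0} β_j^{−1} ⟨z,w⟩^j. -/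

import Mathlib

open scoped ComplexConjugate

/-- `ρ_m(𝐤)`; in particular `ρ₁(𝐤) = |𝐤|!/𝐤!`. -/
noncomputable def rho {n : ℕ} (m : ℕ) (k : Fin n → ℕ) : ℝ :=
  if m = 0 then (if k = 0 then 1 else 0)
  else (Nat.factorial (m + (∑ i, k i) - 1) : ℝ) /
    (((∏ i, Nat.factorial (k i)) * Nat.factorial (m - 1) : ℕ) : ℝ)

theorem rho_one_eq_multinomial {n : ℕ} (k : Fin n → ℕ) :
    rho 1 k = Nat.multinomial Finset.univ k := by
  have h := Nat.multinomial_spec Finset.univ k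
  have hpos : ((∏ i, (k i).factorial : ℕ) : ℝ) ≠ 0 := by
    exact_mod_cast (Nat.prod_factorial_pos _ _).ne'
  simp only [rho, one_ne_zero, if_false, Nat.add_sub_cancel_left, Nat.sub_self,
    Nat.factorial_zero, mul_one]
  rw [div_eq_iff hpos, mul_comm]
  exact_mod_cast h.symm

/-- The multinomial theorem, as a sum over the multi-indices of a given degree. -/
theorem hasSum_multinomial_fiber {R : Type*} [CommSemiring R] [TopologicalSpace R] {n : ℕ}
    (c : ℕ → R) (u : Fin n → R) (j : ℕ) :
    HasSum (fun k : {k : Fin n → ℕ // ∑ i, k i = j} =>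
      c (∑ i, k.1 i) * ((Nat.multinomial Finset.univ k.1 : R) * ∏ i, u i ^ k.1 i))
      (c j * (∑ i, u i) ^ j) := by
  have hmem : ∀ k : Fin n → ℕ, k ∈ Finset.piAntidiag Finset.univ j ↔ ∑ i, k i = j := by
    simp
  rw [Finset.sum_pow_eq_sum_piAntidiag, Finset.mul_sum]
  have h := Finset.hasSum (Finset.piAntidiag Finset.univ j) (fun k : Fin n → ℕ =>
      c (∑ i, k i) * ((Nat.multinomial Finset.univ k : R) * ∏ i, u i ^ k i))
  rw [Finset.sum_congr rfl fun k hk => by rw [(hmem k).1 hk]] at h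
  exact ((Equiv.subtypeEquivRight hmem).symm.hasSum_iff (f := fun k :
    {k : Fin n → ℕ // k ∈ Finset.piAntidiag Finset.univ j} => c (∑ i, k.1 i) *
      ((Nat.multinomial Finset.univ k.1 : R) * ∏ i, u i ^ k.1 i))).2 h

theorem summable_multinomial {n : ℕ} {c : ℕ → ℝ} {u : Fin n → ℝ} (hc : ∀ j, 0 ≤ c j)
    (hu : ∀ i, 0 ≤ u i) (h : Summable fun j => c j * (∑ i, u i) ^ j) :
    Summable fun k : Fin n → ℕ =>
      c (∑ i, k i) * ((Nat.multinomial Finset.univ k : ℝ) * ∏ i, u i ^ k i) := by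
  rw [← (Equiv.sigmaFiberEquiv fun k : Fin n → ℕ => ∑ i, k i).summable_iff,
    summable_sigma_of_nonneg]
  · refine ⟨fun j => (hasSum_multinomial_fiber c u j).summable, ?_⟩
    exact h.congr fun j => (hasSum_multinomial_fiber c u j).tsum_eq.symm
  · intro k
    exact mul_nonneg (hc _) (mul_nonneg (Nat.cast_nonneg _)
      (Finset.prod_nonneg fun i _ => pow_nonneg (hu i) _))

theorem tsum_multinomial {n : ℕ} {c : ℕ → ℂ} {u : Fin n → ℂ}
    (h : Summable fun k : Fin n → ℕ =>
      c (∑ i, k i) * ((Nat.multinomial Finset.univ k : ℂ) * ∏ i, u i ^ k i)) :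
    ∑' k : Fin n → ℕ, c (∑ i, k i) * ((Nat.multinomial Finset.univ k : ℂ) * ∏ i, u i ^ k i) =
      ∑' j, c j * (∑ i, u i) ^ j := by
  have h' := (Equiv.sigmaFiberEquiv fun k : Fin n → ℕ => ∑ i, k i).hasSum_iff.2 h.hasSum
  exact (h'.sigma fun j => hasSum_multinomial_fiber c u j).tsum_eq.symm

theorem summable_inv_mul_pow_of_one_le_liminf {β : ℕ → ℝ} (hpos : ∀ j, 0 < β j)
    (hliminf : 1 ≤ Filter.liminf (fun j : ℕ => (β j) ^ (1 / (j : ℝ))) Filter.atTop)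
    {t : ℝ} (ht0 : 0 ≤ t) (ht1 : t < 1) : Summable fun j => (β j)⁻¹ * t ^ j := by
  obtain ⟨s, hts, hs1⟩ := exists_between ht1
  have hs0 : 0 < s := ht0.trans_lt hts
  have hbdd : Filter.atTop.IsBoundedUnder (· ≥ ·) fun j : ℕ => (β j) ^ (1 / (j : ℝ)) :=
    Filter.isBoundedUnder_of ⟨0, fun j => Real.rpow_nonneg (hpos j).le _⟩
  have hev := Filter.eventually_lt_of_lt_liminf (hs1.trans_le hliminf) hbdd
  refine Summable.of_norm_bounded_eventually_nat
    (summable_geometric_of_lt_one (div_nonneg ht0 hs0.le) ((div_lt_one hs0).2 hts)) ?_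
  filter_upwards [hev, Filter.eventually_ge_atTop 1] with j hj hj1
  have hsj : s ^ j ≤ β j := by
    have h := pow_le_pow_left₀ hs0.le hj.le j
    rwa [one_div, Real.rpow_inv_natCast_pow (hpos j).le (by omega)] at h
  rw [Real.norm_of_nonneg (mul_nonneg (inv_nonneg.2 (hpos j).le) (pow_nonneg ht0 j)), div_pow,
    div_eq_inv_mul]
  gcongr

/-- Summation by parts against the geometric kernel. -/
theorem tsum_mul_pow_eq_one_sub_mul_tsum {b c : ℕ → ℂ} {x : ℂ} (h0 : c 0 = b 0)
    (hsucc : ∀ j, c (j + 1) = b (j + 1) - b j) (hb : Summable fun j => b j * x ^ j) :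
    ∑' j, c j * x ^ j = (1 - x) * ∑' j, b j * x ^ j := by
  have hb' : HasSum (fun j => b (j + 1) * x ^ (j + 1)) (∑' j, b j * x ^ j - b 0) := by
    simpa using (hasSum_nat_add_iff' 1).2 hb.hasSum
  have hc : HasSum (fun j => c (j + 1) * x ^ (j + 1))
      (∑' j, b j * x ^ j - b 0 - x * ∑' j, b j * x ^ j) := by
    refine (hb'.sub (hb.hasSum.mul_left x)).congr_fun ?_
    intro j
    rw [hsucc]
    ring
  have h : HasSum (fun j => c j * x ^ j) ((1 - x) * ∑' j, b j * x ^ j) := by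
    rw [← hasSum_nat_add_iff' 1, Finset.sum_range_one, pow_zero, mul_one, h0, one_sub_mul,
      sub_right_comm]
    exact hc
  exact h.tsum_eq

theorem sum_norm_mul_norm_lt_one {n : ℕ} {z w : EuclideanSpace ℂ (Fin n)}
    (hz : ‖z‖ < 1) (hw : ‖w‖ < 1) : ∑ i, ‖z i‖ * ‖w i‖ < 1 := by
  have h : ∑ i, ‖z i‖ * ‖w i‖ ≤ ∑ i, (‖z i‖ ^ 2 + ‖w i‖ ^ 2) / 2 :=
    Finset.sum_le_sum fun i _ => by nlinarith [sq_nonneg (‖z i‖ - ‖w i‖)]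
  rw [← Finset.sum_div, Finset.sum_add_distrib, ← EuclideanSpace.norm_sq_eq,
    ← EuclideanSpace.norm_sq_eq] at h
  nlinarith [norm_nonneg z, norm_nonneg w]

/-- For a weight sequence `β` with associated sequence `γ` and `z, w ∈ 𝔹ⁿ`, the family
`(ρ₁(𝐤)/γ_{|𝐤|} z^𝐤 w̄^𝐤)_𝐤` is absolutely summable and
`Σ_𝐤 (ρ₁(𝐤)/γ_{|𝐤|}) z^𝐤 w̄^𝐤 = Σ_j γ_j⁻¹ ⟨z,w⟩^j = (1 − ⟨z,w⟩) Σ_j β_j⁻¹ ⟨z,w⟩^j`,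
i.e. `Ψ_{β,ℰ}(z)Ψ_{β,ℰ}(w)* = (1 − ⟨z,w⟩) K_β(z,w) I_ℰ`. -/
theorem universal_multiplier_kernel_identity {n : ℕ} (β γ : ℕ → ℝ)
    (hβpos : ∀ j, 0 < β j) (hβanti : StrictAnti β) (hβ0 : β 0 = 1)
    (hβliminf : 1 ≤ Filter.liminf (fun j : ℕ => (β j) ^ (1 / (j : ℝ))) Filter.atTop)
    (hγ0 : γ 0 = 1)
    (hγ : ∀ j : ℕ, 1 ≤ j → γ j = (1 / β j - 1 / β (j - 1))⁻¹)
    (z w : EuclideanSpace ℂ (Fin n))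
    (hz : z ∈ Metric.ball (0 : EuclideanSpace ℂ (Fin n)) 1)
    (hw : w ∈ Metric.ball (0 : EuclideanSpace ℂ (Fin n)) 1) :
    Summable (fun k : Fin n → ℕ =>
      ‖((rho 1 k / γ (∑ i, k i) : ℝ) : ℂ) * (∏ i, z i ^ k i) * ∏ i, conj (w i) ^ k i‖) ∧
    ∑' k : Fin n → ℕ,
        ((rho 1 k / γ (∑ i, k i) : ℝ) : ℂ) * (∏ i, z i ^ k i) * ∏ i, conj (w i) ^ k i
      = ∑' j : ℕ, ((γ j)⁻¹ : ℂ) * (∑ i, z i * conj (w i)) ^ j ∧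
    ∑' j : ℕ, ((γ j)⁻¹ : ℂ) * (∑ i, z i * conj (w i)) ^ j
      = (1 - ∑ i, z i * conj (w i)) *
          ∑' j : ℕ, ((β j)⁻¹ : ℂ) * (∑ i, z i * conj (w i)) ^ j := by
  rw [mem_ball_zero_iff] at hz hw
  have hγ_succ : ∀ j, (γ (j + 1))⁻¹ = (β (j + 1))⁻¹ - (β j)⁻¹ := fun j => by
    simp [hγ (j + 1) (by omega)]
  have hγ_nonneg : ∀ j, 0 ≤ (γ j)⁻¹ := by
    rintro (_ | j)
    · simp [hγ0]
    · rw [hγ_succ, sub_nonneg]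
      exact inv_anti₀ (hβpos _) (hβanti (Nat.lt_succ_self j)).le
  have hγ_le : ∀ j, (γ j)⁻¹ ≤ (β j)⁻¹ := by
    rintro (_ | j)
    · simp [hγ0, hβ0]
    · rw [hγ_succ]
      linarith [inv_pos.2 (hβpos j)]
  set u : Fin n → ℂ := fun i => z i * conj (w i) with hu
  have hnorm_u : ∀ i, ‖u i‖ = ‖z i‖ * ‖w i‖ := fun i => by simp [hu]
  have hT0 : 0 ≤ ∑ i, ‖u i‖ := Finset.sum_nonneg fun i _ => norm_nonneg _
  have hT1 : ∑ i, ‖u i‖ < 1 := by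
    simpa only [hnorm_u] using sum_norm_mul_norm_lt_one hz hw
  have hβ_summable := summable_inv_mul_pow_of_one_le_liminf hβpos hβliminf hT0 hT1
  have hγ_summable : Summable fun j => (γ j)⁻¹ * (∑ i, ‖u i‖) ^ j :=
    hβ_summable.of_nonneg_of_le (fun j => mul_nonneg (hγ_nonneg j) (pow_nonneg hT0 j))
      fun j => mul_le_mul_of_nonneg_right (hγ_le j) (pow_nonneg hT0 j)
  have hterm : ∀ k : Fin n → ℕ,
      ((rho 1 k / γ (∑ i, k i) : ℝ) : ℂ) * (∏ i, z i ^ k i) * ∏ i, conj (w i) ^ k i =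
        ((γ (∑ i, k i))⁻¹ : ℂ) * ((Nat.multinomial Finset.univ k : ℂ) * ∏ i, u i ^ k i) := by
    intro k
    simp only [hu, mul_pow, Finset.prod_mul_distrib, rho_one_eq_multinomial]
    push_cast
    ring
  have habs : Summable fun k : Fin n → ℕ =>
      ‖((γ (∑ i, k i))⁻¹ : ℂ) * ((Nat.multinomial Finset.univ k : ℂ) * ∏ i, u i ^ k i)‖ := by
    refine (summable_multinomial hγ_nonneg (fun i => norm_nonneg (u i)) hγ_summable).congr ?_
    intro k
    rw [← Complex.ofReal_inv, norm_mul, norm_mul, Complex.norm_of_nonneg (hγ_nonneg _),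
      Complex.norm_natCast, norm_prod]
    simp only [norm_pow]
  simp only [hterm]
  refine ⟨habs, tsum_multinomial (c := fun j => ((γ j)⁻¹ : ℂ)) habs.of_norm,
    tsum_mul_pow_eq_one_sub_mul_tsum (by simp [hγ0, hβ0])
      (fun j => by exact_mod_cast hγ_succ j) ?_⟩
  refine Summable.of_norm_bounded hβ_summable fun j => ?_
  rw [← Complex.ofReal_inv, norm_mul, norm_pow,
    Complex.norm_of_nonneg (inv_nonneg.2 (hβpos j).le)]
  exact mul_le_mul_of_nonneg_left (pow_le_pow_left₀ (norm_nonneg _) (norm_sum_le _ _) j)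
    (inv_nonneg.2 (hβpos j).le)
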